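/- arXiv:2307.00770 — 2 statements merged into one kernel-verified Lean document; each statement's English description precedes it below -/
import Mathlib

section
/- Every prime v-palindrome is of the form 5·10^m - 1 for some integer m ≥ 4, with 5·10^m - 3 also prime. Conversely, every prime of the form 5·10^m - 1 with m ≥ 4 such that 5·10^m - 3 is also prime is a v-palindrome. -/
def r (n : ℕ) : ℕ := Nat.ofDigits 10 ((Nat.digits 10 n).reverse)

def v (n : ℕ) : ℤ :=
  ∑ p ∈ n.primeFactors,
    ((p : ℤ) + if 2 ≤ n.factorization p then (n.factorization p : ℤ) else 0)

theorem v_one : v 1 = 0 := by simp [v]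

theorem v_mul {a b : ℕ} (h : a.Coprime b) : v (a * b) = v a + v b := by
  unfold v
  rw [h.primeFactors_mul, Finset.sum_union h.disjoint_primeFactors]
  congr 1
  · refine Finset.sum_congr rfl fun q hq => ?_
    rw [Nat.factorization_eq_of_coprime_left h (by simpa using hq)]
  · refine Finset.sum_congr rfl fun q hq => ?_
    rw [Nat.factorization_eq_of_coprime_right h (by simpa using hq)]

theorem v_prime_pow {q a : ℕ} (hq : q.Prime) (ha : 0 < a) :
    v (q ^ a) = q + if 2 ≤ a then (a : ℤ) else 0 := by
  unfold v
  rw [Nat.primeFactors_prime_pow ha.ne' hq]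
  simp [hq.factorization_self]

theorem v_prime {q : ℕ} (hq : q.Prime) : v q = q := by
  have := v_prime_pow hq (a := 1) one_pos
  simpa using this

theorem add_le_pow {q a : ℕ} (hq : 2 ≤ q) (ha : 2 ≤ a) : q + a ≤ q ^ a := by
  induction a, ha using Nat.le_induction with
  | base => nlinarith
  | succ n hn ih => rw [pow_succ]; nlinarith

theorem v_le (n : ℕ) (hn : n ≠ 0) : v n ≤ n := by
  induction n using Nat.recOnPosPrimePosCoprime with
  | prime_pow q a hq ha =>
    rw [v_prime_pow hq ha]
    split_ifs with h
    · exact_mod_cast add_le_pow hq.two_le h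
    · have : a = 1 := by omega
      subst this; simp
  | zero => simp at hn
  | one => simp [v_one]
  | coprime a b ha hb hab iha ihb =>
    rw [v_mul hab]
    have h1 := iha (by omega)
    have h2 := ihb (by omega)
    push_cast
    have : (2 : ℤ) ≤ a := by exact_mod_cast ha
    have : (2 : ℤ) ≤ b := by exact_mod_cast hb
    nlinarith

theorem rev_all_nine (s : List ℕ) : (∀ x ∈ s, x < 10) →
    Nat.ofDigits 10 s.reverse + 10 ^ s.length = 1 + 2 * Nat.ofDigits 10 s →
    Nat.ofDigits 10 s + 1 = 10 ^ s.length := by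
  induction s using List.bidirectionalRec with
  | nil => simp
  | singleton a => intro h; simp; omega
  | cons_append c l d ih =>
    intro h he
    have hc : c < 10 := h c (by simp)
    have hd : d < 10 := h d (by simp)
    have hl : ∀ x ∈ l, x < 10 := fun x hx => h x (by simp [hx])
    have ih := ih hl
    have h1 := Nat.ofDigits_lt_base_pow_length (b := 10) (by norm_num) hl
    have h2 := Nat.ofDigits_lt_base_pow_length (b := 10) (l := l.reverse) (by norm_num) (by simpa using hl)
    simp only [List.reverse_cons, List.reverse_append, List.reverse_nil, List.nil_append,
      List.cons_append, List.singleton_append, Nat.ofDigits_cons, Nat.ofDigits_append, Nat.ofDigits_nil, Nat.cast_id, mul_zero, add_zero,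
      List.length_cons, List.length_append, List.length_nil, List.length_reverse, pow_succ, zero_add, pow_zero, one_mul] at *
    generalize Nat.ofDigits 10 l = N at *
    generalize Nat.ofDigits 10 l.reverse = N' at *
    generalize 10 ^ l.length = T at *
    interval_cases d <;> interval_cases c <;> omega

theorem v_ne_mul {n p a b : ℕ} (h : a.Coprime b) (hn : n = a * b) (ha : a ≠ 0) (hb : b ≠ 0)
    (hlt : a + b < p) : (p : ℤ) ≠ v n := by
  subst hn
  have h1 := v_le a ha
  have h2 := v_le b hb
  rw [v_mul h]
  omega

theorem v_ne_lt {n p : ℕ} (hn : n ≠ 0) (hlt : n < p) : (p : ℤ) ≠ v n := by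
  have h1 := v_le n hn
  omega

theorem v_ne_prime {n p : ℕ} (hn : n.Prime) (hne : p ≠ n) : (p : ℤ) ≠ v n := by
  rw [v_prime hn]
  exact_mod_cast hne

theorem small_case (p : ℕ) (hlt : p < 100) (hp : p.Prime) (hne : p ≠ r p) : v p ≠ v (r p) := by
  rw [v_prime hp]
  have hr : r p = Nat.ofDigits 10 ((Nat.digits 10 p).reverse) := rfl
  generalize r p = R at *
  interval_cases p <;> first
    | (exfalso; revert hp; norm_num; done)
    | (norm_num [Nat.ofDigits] at hr
       subst hr
       first
       | exact absurd rfl hne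
       | (refine v_ne_lt ?_ ?_ <;> norm_num; done)
       | (refine v_ne_prime ?_ ?_ <;> norm_num; done)
       | skip)
  · have h := v_mul (a := 7) (b := 13) (by norm_num)
    rw [v_prime (q := 7) (by norm_num), v_prime (q := 13) (by norm_num)] at h
    norm_num at h ⊢
    omega
  · have h := v_prime_pow (q := 2) (a := 5) (by norm_num) (by norm_num)
    norm_num at h ⊢
    omega
  · exact v_ne_mul (a := 4) (b := 23) (by norm_num) (by norm_num) (by norm_num) (by norm_num) (by norm_num)
  · exact v_ne_mul (a := 2) (b := 37) (by norm_num) (by norm_num) (by norm_num) (by norm_num) (by norm_num)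
  · exact v_ne_mul (a := 5) (b := 19) (by norm_num) (by norm_num) (by norm_num) (by norm_num) (by norm_num)
  · exact v_ne_mul (a := 4) (b := 19) (by norm_num) (by norm_num) (by norm_num) (by norm_num) (by norm_num)
  · exact v_ne_mul (a := 2) (b := 49) (by norm_num) (by norm_num) (by norm_num) (by norm_num) (by norm_num)

/-- Structure of numbers with large `v`. -/
theorem structure_lemma (R T : ℕ) (hT : T = 100 ∨ 1000 ≤ T) (hR : R < 10 * T) (hR0 : R ≠ 0) (h10 : ¬ 10 ∣ R)
    (hv : (T : ℤ) ≤ v R) (hv1 : v R ≠ 100) (hv2 : v R ≠ 101) :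
    ∃ k q, q.Prime ∧ 11 ≤ q ∧ 1 ≤ k ∧ k ≤ 9 ∧ R = q * k ∧ v R = q + v k := by
  by_cases hex : ∃ q ∈ R.primeFactors, 11 ≤ q ^ R.factorization q
  · obtain ⟨q, hq, hQ⟩ := hex
    have hqp := Nat.prime_of_mem_primeFactors hq
    have hqd := Nat.dvd_of_mem_primeFactors hq
    have ha : 0 < R.factorization q := hqp.factorization_pos_of_dvd hR0 hqd
    have hmul := Nat.ordProj_mul_ordCompl_eq_self R q
    have hcop : (q ^ R.factorization q).Coprime (R / q ^ R.factorization q) :=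
      (Nat.coprime_ordCompl hqp hR0).pow_left _
    generalize R / q ^ R.factorization q = k at *
    generalize R.factorization q = a at *
    have hk0 : k ≠ 0 := by rintro rfl; simp at hmul; omega
    have hvR := v_mul hcop
    rw [hmul] at hvR
    have hvk := v_le k hk0
    have hk : k ≤ 9 := by
      by_contra hk
      have hk : 11 ≤ k := by
        have : k ≠ 10 := by rintro rfl; exact h10 ⟨_, by rw [← hmul, mul_comm]⟩
        omega
      have hvQ := v_le (q ^ a) (by omega)
      generalize q ^ a = Q at *
      have : 11 * (Q + k) ≤ R + 121 := by nlinarith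
      omega
    by_cases ha1 : a = 1
    · subst ha1
      simp only [pow_one] at *
      exact ⟨k, q, hqp, hQ, by omega, hk, hmul.symm, by rw [hvR, v_prime hqp]⟩
    · exfalso
      have ha2 : 2 ≤ a := by omega
      rw [v_prime_pow hqp ha, if_pos ha2] at hvR
      have h1 : q ^ a ≤ R := by rw [← hmul]; exact Nat.le_mul_of_pos_right _ (by omega)
      have h2 : q ^ 2 ≤ q ^ a := Nat.pow_le_pow_right hqp.pos ha2
      have h3 : 2 ^ a ≤ q ^ a := Nat.pow_le_pow_left hqp.two_le a
      have hT100 : 100 ≤ T := by omega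
      have hqq : q * q < 10 * T := by rw [← pow_two]; omega
      have h4 : 3 * q ≤ T + 3 := by
        by_contra hcon
        have hcon : T + 4 ≤ 3 * q := by omega
        have := Nat.mul_le_mul hcon hcon
        nlinarith
      have h5 : ∀ a, 8 ≤ a → 30 * a ≤ 2 ^ a + 0 := by
        intro a ha
        induction a, ha using Nat.le_induction with
        | base => norm_num
        | succ n hn ih => rw [pow_succ]; omega
      rcases lt_or_ge a 8 with h8 | h8
      · omega
      · have := h5 a h8
        omega
  · exfalso
    push Not at hex
    have hsub : R.primeFactors ⊆ Finset.range 11 := by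
      intro q hq
      have := hex q hq
      have hqp := Nat.prime_of_mem_primeFactors hq
      have ha : 0 < R.factorization q := hqp.factorization_pos_of_dvd hR0 (Nat.dvd_of_mem_primeFactors hq)
      have := Nat.le_self_pow ha.ne' q
      simp; omega
    have hsub : R.primeFactors ⊆ {2, 3, 5, 7} := by
      intro q hq
      have h1 := hsub hq
      have hqp := Nat.prime_of_mem_primeFactors hq
      simp at h1
      interval_cases q <;> first | (simp; done) | (exfalso; revert hqp; norm_num)
    have hb : ∀ q ∈ R.primeFactors, ((q : ℤ) + if 2 ≤ R.factorization q then (R.factorization q : ℤ) else 0) ≤ (10 : ℤ) := by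
      intro q hq
      have h1 := hex q hq
      have hqp := Nat.prime_of_mem_primeFactors hq
      have ha : 0 < R.factorization q := hqp.factorization_pos_of_dvd hR0 (Nat.dvd_of_mem_primeFactors hq)
      have h2 := v_le (q ^ R.factorization q) (by have := hqp.pos; positivity)
      rw [v_prime_pow hqp ha] at h2
      refine h2.trans ?_
      exact_mod_cast (by omega : q ^ R.factorization q ≤ 10)
    have h1 : v R ≤ ∑ q ∈ R.primeFactors, (10 : ℤ) := Finset.sum_le_sum hb
    have h2 := Finset.card_le_card hsub
    simp at h1 h2
    omega

theorem v_two : v 2 = 2 := v_prime Nat.prime_two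
theorem v_three : v 3 = 3 := v_prime Nat.prime_three
theorem v_five : v 5 = 5 := v_prime Nat.prime_five
theorem v_seven : v 7 = 7 := v_prime (by norm_num)
theorem v_four : v 4 = 4 := by
  have := v_prime_pow (a := 2) Nat.prime_two (by norm_num); norm_num at this; exact this
theorem v_eight : v 8 = 5 := by
  have := v_prime_pow (a := 3) Nat.prime_two (by norm_num); norm_num at this; exact this
theorem v_nine : v 9 = 5 := by
  have := v_prime_pow (a := 2) Nat.prime_three (by norm_num); norm_num at this; exact this
theorem v_six : v 6 = 5 := by
  have := v_mul (a := 2) (b := 3) (by norm_num); rw [v_two, v_three] at this; norm_num at this; exact this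

theorem digits_lemma (a b M M' T : ℕ) (ha : a < 10) (hb : b < 10) (h1 : M < T) (h2 : M' < T)
    (ha2 : a % 2 = 1) (ha5 : a % 5 ≠ 0)
    (h : b + 10 * (M' + T * a) + 4 = 2 * (a + 10 * (M + T * b))) : a = 9 ∧ b = 4 := by
  interval_cases a <;> first | omega | (interval_cases b <;> omega)

set_option maxHeartbeats 2000000 in
theorem forward (p : ℕ) (hp : p.Prime) (hne : p ≠ r p) (hv : v p = v (r p)) :
    ∃ m : ℕ, 4 ≤ m ∧ p = 5 * 10 ^ m - 1 ∧ (5 * 10 ^ m - 3).Prime := by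
  have hbig : 100 ≤ p := by
    by_contra h
    exact small_case p (by omega) hp hne hv
  have hpv := v_prime hp
  have hdig : ∀ x ∈ Nat.digits 10 p, x < 10 := fun x hx => Nat.digits_lt_base (by norm_num) hx
  have hpd := Nat.ofDigits_digits 10 p
  have hlast := Nat.getLast_digit_ne_zero 10 hp.ne_zero
  have h101 : p ≠ 101 := by
    rintro rfl
    apply hne; simp [r, Nat.ofDigits]
  have hr : r p = Nat.ofDigits 10 ((Nat.digits 10 p).reverse) := rfl
  have hmod : p % 9 = r p % 9 := by
    have h1 := Nat.modEq_nine_digits_sum p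
    have h2 := Nat.ofDigits_mod 10 9 (Nat.digits 10 p).reverse
    rw [← hr] at h2
    have h3 := Nat.ofDigits_modEq' 10 1 9 (by decide) (Nat.digits 10 p).reverse
    rw [Nat.ofDigits_one, List.sum_reverse, ← hr] at h3
    exact h1.trans h3.symm
  have hlen : 3 ≤ (Nat.digits 10 p).length := by
    by_contra h
    have := Nat.lt_base_pow_length_digits (b := 10) (m := p) (by norm_num)
    have h2 : 10 ^ (Nat.digits 10 p).length ≤ 10 ^ 2 := Nat.pow_le_pow_right (by norm_num) (by omega)
    omega
  generalize r p = R at *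
  obtain ⟨a, mid, b, hl⟩ : ∃ a mid b, Nat.digits 10 p = a :: (mid ++ [b]) := by
    rcases hd : Nat.digits 10 p with _ | ⟨a, t⟩
    · simp [hd] at hlen
    · rcases List.eq_nil_or_concat t with rfl | ⟨mid, b, rfl⟩
      · simp [hd] at hlen
      · exact ⟨a, mid, b, by simp⟩
  simp only [hl] at hdig hpd hr hlen hlast
  have hb0 : b ≠ 0 := by simpa using hlast
  have ha : a < 10 := hdig a (by simp)
  have hb : b < 10 := hdig b (by simp)
  have hm : ∀ x ∈ mid, x < 10 := fun x hx => hdig x (by simp [hx])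
  have h1 := Nat.ofDigits_lt_base_pow_length (b := 10) (by norm_num) hm
  have h2 := Nat.ofDigits_lt_base_pow_length (b := 10) (l := mid.reverse) (by norm_num) (by simpa using hm)
  have hnine := rev_all_nine mid hm
  have hn : 1 ≤ mid.length := by simp at hlen; omega
  have hT : 10 ≤ 10 ^ mid.length := Nat.le_self_pow (by omega) 10
  have hT' : mid.length = 1 ∨ 10 ^ 2 ≤ 10 ^ mid.length := by
    rcases hn.eq_or_lt with h | h
    · exact Or.inl h.symm
    · exact Or.inr (Nat.pow_le_pow_right (by norm_num) h)
  clear hl hdig hlast hm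
  simp only [List.reverse_cons, List.reverse_append, List.reverse_nil, List.nil_append,
      List.cons_append, List.singleton_append, Nat.ofDigits_cons, Nat.ofDigits_append, Nat.ofDigits_nil, Nat.cast_id, mul_zero, add_zero,
      List.length_reverse] at *
  clear hlen
  generalize mid.length = n at *
  generalize Nat.ofDigits 10 mid = M at *
  generalize Nat.ofDigits 10 mid.reverse = M' at *
  have h2p : ¬ 2 ∣ p := fun h => by
    have := (Nat.prime_dvd_prime_iff_eq Nat.prime_two hp).1 h; omega
  have h3p : ¬ 3 ∣ p := fun h => by
    have := (Nat.prime_dvd_prime_iff_eq Nat.prime_three hp).1 h; omega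
  have h5p : ¬ 5 ∣ p := fun h => by
    have := (Nat.prime_dvd_prime_iff_eq Nat.prime_five hp).1 h; omega
  have hT10 : 10 * 10 ^ n = 100 ∨ 1000 ≤ 10 * 10 ^ n := by
    rcases hT' with h | h
    · left; rw [h]; norm_num
    · right; omega
  clear hT'
  generalize hTe : 10 ^ n = T at *
  have hTa : T * a ≤ T * 9 := Nat.mul_le_mul_left _ (by omega)
  have hTb : T * 1 ≤ T * b := Nat.mul_le_mul_left _ (by omega)
  obtain ⟨k, q, hq, hq11, hk1, hk9, hRk, hvk⟩ := structure_lemma R (10 * T) hT10 (by omega) (by omega)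
    (by omega) (by omega) (by rw [← hv, hpv]; intro h; have : p = 100 := by exact_mod_cast h
                              omega) (by omega)
  rw [← hv, hpv] at hvk
  have hq2 : ¬ 2 ∣ q := fun h => by
    have := (Nat.prime_dvd_prime_iff_eq Nat.prime_two hq).1 h; omega
  have key : k = 2 ∧ p = q + 2 := by
    clear hnine hv hpv hn hTe
    interval_cases k
    · rw [v_one] at hvk; omega
    · rw [v_two] at hvk; omega
    · rw [v_three] at hvk; omega
    · rw [v_four] at hvk; omega
    · rw [v_five] at hvk
      exfalso
      have : b = 5 := by clear hmod hTa hTb h1 h2; omega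
      subst this; omega
    · rw [v_six] at hvk; omega
    · rw [v_seven] at hvk; omega
    · rw [v_eight] at hvk
      exfalso
      have : 2 ≤ b := by clear hmod hTa hTb h1 h2; omega
      have : T * 2 ≤ T * b := Nat.mul_le_mul_left _ this
      clear hmod
      omega
    · rw [v_nine] at hvk; omega
  obtain ⟨rfl, hpq⟩ := key
  have hab : a = 9 ∧ b = 4 :=
    digits_lemma a b M M' T ha hb h1 h2 (by omega) (by omega) (by omega)
  obtain ⟨rfl, rfl⟩ := hab
  have hM := hnine (by omega)
  have hpow : 10 ^ (n + 1) = 10 * T := by rw [pow_succ, hTe, mul_comm]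
  have hqe : 5 * 10 ^ (n + 1) - 3 = q := by omega
  refine ⟨n + 1, ?_, by omega, hqe ▸ hq⟩
  by_contra hlt
  have : n = 1 ∨ n = 2 := by omega
  rcases this with h | h
  · rw [h] at hqe; rw [← hqe] at hq; revert hq; norm_num
  · rw [h] at hqe; rw [← hqe] at hq; revert hq; norm_num

theorem ofDigits_nines (m : ℕ) : Nat.ofDigits 10 (List.replicate m 9) + 1 = 10 ^ m := by
  induction m with
  | zero => simp
  | succ n ih => rw [List.replicate_succ, Nat.ofDigits_cons, pow_succ]; omega

theorem r_special (m : ℕ) : r (5 * 10 ^ m - 1) = 2 * (5 * 10 ^ m - 3) := by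
  have h9 := ofDigits_nines m
  have h : 5 * 10 ^ m - 1 = Nat.ofDigits 10 (List.replicate m 9 ++ [4]) := by
    rw [Nat.ofDigits_append, List.length_replicate, Nat.ofDigits_singleton]; omega
  have hd : Nat.digits 10 (5 * 10 ^ m - 1) = List.replicate m 9 ++ [4] := by
    rw [h, Nat.digits_ofDigits 10 (by norm_num)]
    · intro x hx
      simp at hx; omega
    · simp
  unfold r
  rw [hd]
  simp only [List.reverse_append, List.reverse_singleton, List.singleton_append, List.reverse_replicate,
    Nat.ofDigits_cons, Nat.cast_ofNat]
  omega

theorem stmt_14 (p : ℕ) (hp : p.Prime) :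
    (¬ 10 ∣ p ∧ p ≠ r p ∧ v p = v (r p)) ↔
      ∃ m : ℕ, 4 ≤ m ∧ p = 5 * 10 ^ m - 1 ∧ (5 * 10 ^ m - 3).Prime := by
  constructor
  · rintro ⟨-, h1, h2⟩
    exact forward p hp h1 h2
  · rintro ⟨m, hm, hpm, hq⟩
    have h4 : 10 ^ 4 ≤ 10 ^ m := Nat.pow_le_pow_right (by norm_num) hm
    have hr := r_special m
    rw [← hpm] at hr
    have hodd : ¬ 2 ∣ 5 * 10 ^ m - 3 := fun h => by
      have := (Nat.prime_dvd_prime_iff_eq Nat.prime_two hq).1 h; omega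
    refine ⟨fun h => ?_, by omega, ?_⟩
    · have : 2 ∣ p := by omega
      have := (Nat.prime_dvd_prime_iff_eq Nat.prime_two hp).1 this; omega
    · rw [hr, v_mul ((Nat.Prime.coprime_iff_not_dvd Nat.prime_two).2 hodd), v_two, v_prime hq, v_prime hp]
      omega
end

section
/- There are no prime v-palindromes with fewer than 5 decimal digits, i.e., no prime p < 10^4 satisfies 10 ∤ p, p ≠ r(p), and v(p) = v(r(p)). -/
theorem v_pow {k a : ℕ} (hk : k.Prime) (ha : 1 ≤ a) :
    v (k ^ a) = ((k + (if 2 ≤ a then a else 0) : ℕ) : ℤ) := by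
  unfold v
  rw [Nat.primeFactors_prime_pow (by omega) hk]
  simp [hk.factorization]

theorem v_prime_s15 {k : ℕ} (hk : k.Prime) : v k = k := by
  have := v_pow hk (le_refl 1)
  simpa using this

/-- Divide out `k` as often as possible (at most `f - 1` times). -/
def strip (k : ℕ) : ℕ → ℕ → ℕ → Option (ℕ × ℕ)
  | 0, _, _ => none
  | f + 1, a, n => bif Nat.beq (n % k) 0 then strip k f (a + 1) (n / k) else some (a, n)

theorem strip_spec (k : ℕ) : ∀ (f a n b m : ℕ), strip k f a n = some (b, m) →
    k ^ a * n = k ^ b * m ∧ ¬ k ∣ m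
  | 0, _, _, _, _, h => by simp [strip] at h
  | f + 1, a, n, b, m, h => by
    unfold strip at h
    cases hc : Nat.beq (n % k) 0 with
    | true =>
      rw [hc] at h
      have h0 : k ∣ n := Nat.dvd_of_mod_eq_zero (Nat.eq_of_beq_eq_true hc)
      obtain ⟨h1, h2⟩ := strip_spec k f _ _ _ _ h
      refine ⟨?_, h2⟩
      rw [← h1, pow_succ, mul_assoc, Nat.mul_div_cancel' h0]
    | false =>
      rw [hc] at h
      have h0 : ¬ k ∣ n := fun hd => Nat.ne_of_beq_eq_false hc (Nat.mod_eq_zero_of_dvd hd)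
      simp only [cond_false, Option.some.injEq, Prod.mk.injEq] at h
      obtain ⟨rfl, rfl⟩ := h
      exact ⟨rfl, h0⟩

/-- Compute `v n` by trial division, starting with the divisor `102 - f`. -/
def vcalc : ℕ → ℕ → ℕ → Option ℕ
  | 0, _, _ => none
  | f + 1, n, acc =>
    bif Nat.ble n 1 then some acc
    else bif Nat.ble (n + 1) ((101 - f) * (101 - f)) then some (acc + n)
    else bif Nat.beq (n % (101 - f)) 0 then
      match strip (101 - f) 20 0 n with
      | none => none
      | some (a, m) => vcalc f m (acc + (101 - f) + bif Nat.ble 2 a then a else 0)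
    else vcalc f n acc

theorem vcalc_spec : ∀ (f n acc w : ℕ), f ≤ 100 → n ≠ 0 →
    (∀ q, q.Prime → q ∣ n → 102 - f ≤ q) →
    vcalc f n acc = some w → (w : ℤ) = acc + v n
  | 0, _, _, _, _, _, _, h => by simp [vcalc] at h
  | f + 1, n, acc, w, hf, hn, hq, h => by
    unfold vcalc at h
    have hk : 102 - (f + 1) = 101 - f := by omega
    have hk2 : 102 - f = (101 - f) + 1 := by omega
    have hk3 : 2 ≤ 101 - f := by omega
    rw [hk] at hq
    generalize 101 - f = k at *
    cases h1 : Nat.ble n 1 with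
    | true =>
      have : n = 1 := by have := Nat.le_of_ble_eq_true h1; omega
      subst this
      rw [h1] at h
      simp at h
      simp [v, h]
    | false =>
      have hn1 : ¬ n ≤ 1 := fun hc => by simp [Nat.ble_eq_true_of_le hc] at h1
      rw [h1] at h
      cases h2 : Nat.ble (n + 1) (k * k) with
      | true =>
        have hlt := Nat.le_of_ble_eq_true h2
        rw [h2] at h
        simp at h
        have hp : n.Prime := by
          by_contra hnp
          have h3 := Nat.minFac_sq_le_self (by omega) hnp
          have h4 := hq _ (Nat.minFac_prime (by omega)) (Nat.minFac_dvd n)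
          have h5 := Nat.mul_le_mul h4 h4
          rw [sq] at h3
          omega
        rw [v_prime_s15 hp, ← h]
        push_cast; rfl
      | false =>
        rw [h2] at h
        cases h3 : Nat.beq (n % k) 0 with
        | true =>
          rw [h3] at h
          have hd : k ∣ n := Nat.dvd_of_mod_eq_zero (Nat.eq_of_beq_eq_true h3)
          have hkp : k.Prime := by
            have h4 := hq _ (Nat.minFac_prime (n := k) (by omega)) ((Nat.minFac_dvd k).trans hd)
            have h5 := Nat.minFac_le (n := k) (by omega)
            have h6 := Nat.minFac_prime (n := k) (by omega)
            rwa [le_antisymm h5 h4] at h6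
          simp only [cond_false, cond_true] at h
          cases hs : strip k 20 0 n with
          | none => simp [hs] at h
          | some am =>
            obtain ⟨a, m⟩ := am
            rw [hs] at h
            obtain ⟨e, hm⟩ := strip_spec _ _ _ _ _ _ hs
            simp only [pow_zero, one_mul] at e
            have ha : 1 ≤ a := by
              by_contra hc
              have : a = 0 := by omega
              subst this
              simp at e
              exact hm (e ▸ hd)
            have hm0 : m ≠ 0 := by rintro rfl; simp at hm
            have key := vcalc_spec f m _ w (by omega) hm0 (fun q hqp hqm => by
              have h7 := hq q hqp (e ▸ Dvd.dvd.mul_left hqm _)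
              have h8 : q ≠ k := by rintro rfl; exact hm hqm
              omega) h
            rw [key, e, v_mul (Nat.Coprime.pow_left _ ((Nat.Prime.coprime_iff_not_dvd hkp).2 hm)),
              v_pow hkp ha]
            by_cases h2a : 2 ≤ a
            · simp [h2a, Nat.ble_eq_true_of_le h2a]; ring
            · have : Nat.ble 2 a = false := by
                cases hb : Nat.ble 2 a with
                | false => rfl
                | true => exact absurd (Nat.le_of_ble_eq_true hb) h2a
              simp [h2a, this]; ring
        | false =>
          rw [h3] at h
          have hd : ¬ k ∣ n := fun hd => Nat.ne_of_beq_eq_false h3 (Nat.mod_eq_zero_of_dvd hd)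
          refine vcalc_spec f n acc w (by omega) hn (fun q hqp hqn => ?_) h
          have h7 := hq q hqp hqn
          have h8 : q ≠ k := by rintro rfl; exact hd hqn
          omega

/-- The finite check for a single `p`. -/
def chk (p : ℕ) : Bool :=
  Nat.beq (p % 2) 0 || Nat.beq (p % 3) 0 || Nat.beq (p % 5) 0 || Nat.beq (p % 7) 0 ||
  Nat.beq p (r p) ||
  match vcalc 100 (r p) 0 with
  | none => false
  | some w => !(Nat.beq w p)

/-- Check a Boolean predicate below a bound. -/
def chkAll (P : ℕ → Bool) : ℕ → Bool
  | 0 => true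
  | n + 1 => P n && chkAll P n

theorem chkAll_spec (P : ℕ → Bool) : ∀ n, chkAll P n = true → ∀ p < n, P p = true
  | 0, _, p, hp => by omega
  | n + 1, h, p, hp => by
    simp only [chkAll, Bool.and_eq_true] at h
    rcases Nat.lt_succ_iff_lt_or_eq.1 hp with h1 | rfl
    · exact chkAll_spec P n h.2 p h1
    · exact h.1

theorem chkAll_true : chkAll (fun a => chkAll (fun b => chk (100 * a + b)) 100) 100 = true := by
  decide +kernel

theorem chk_true (p : ℕ) (hp : p < 10 ^ 4) : chk p = true := by
  have h1 := chkAll_spec _ _ chkAll_true (p / 100) (by omega)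
  have h2 := chkAll_spec _ _ h1 (p % 100) (by omega)
  simpa only [Nat.div_add_mod] using h2

theorem stmt_15 (p : ℕ) (hp : p.Prime) (hlt : p < 10 ^ 4) :
    ¬ (¬ 10 ∣ p ∧ p ≠ r p ∧ v p = v (r p)) := by
  rintro ⟨-, hne, hv⟩
  have h := chk_true p hlt
  have small : ∀ q, q.Prime → q = r q → Nat.beq (p % q) 0 = false := by
    intro q hq hr
    by_contra hc
    have hd := Nat.dvd_of_mod_eq_zero (Nat.eq_of_beq_eq_true (by simpa using hc))
    have := (Nat.prime_dvd_prime_iff_eq hq hp).1 hd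
    subst this
    exact hne hr
  have e : Nat.beq p (r p) = false := by
    by_contra hc
    exact hne (Nat.eq_of_beq_eq_true (by simpa using hc))
  unfold chk at h
  rw [small 2 (by norm_num) (by simp [r]), small 3 (by norm_num) (by simp [r]),
    small 5 (by norm_num) (by simp [r]), small 7 (by norm_num) (by simp [r]), e] at h
  simp only [Bool.false_or] at h
  cases hw : vcalc 100 (r p) 0 with
  | none => simp [hw] at h
  | some w =>
    rw [hw] at h
    have hr0 : r p ≠ 0 := by
      intro h0
      rw [h0, v_prime_s15 hp] at hv
      simp [v] at hv
      exact hp.ne_zero hv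
    have := vcalc_spec 100 (r p) 0 w le_rfl hr0 (fun q hq _ => hq.two_le) hw
    rw [← hv, v_prime_s15 hp] at this
    have hwp : w = p := by push_cast at this; omega
    subst hwp
    simp at h
end
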